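/- arXiv:2003.06950 — 3 statements merged into one kernel-verified Lean document; each statement's English description precedes it below -/
import Mathlib

section
/- There exist a dimension d ≥ 2 and probability mass functions p⁰ and p¹ on the 2d signed standard basis vectors of ℤ^d, with p¹(e) > 0 for every such e and p¹ not balanced, such that δ_{p⁰}·δ_{p¹} < 0 while δ_{p⁰}·ℓ_{p¹} > 0. (Thus the biased random walk on the trace of a biased random walk can be transient even when the two drifts point in opposing directions.) -/
noncomputable section

/-- The signed standard basis vector of `ℤ^d` with index `js.1` and sign given by `js.2`
(`true` for `+`, `false` for `-`). Identifying a pmf on the signed standard basis vectors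
with a function `Fin d × Bool → ℝ`, the drift `δ_p = Σ_e p(e) e` has `j`-th coordinate
`p (j, true) - p (j, false)`. -/
def sgnBasis {d : ℕ} (js : Fin d × Bool) : Fin d → ℤ :=
  Pi.single js.1 (if js.2 then 1 else -1)

/-- **Transience despite opposing drifts**: there exist `d ≥ 2` and pmfs `p⁰`, `p¹` on the
signed standard basis vectors of `ℤ^d` (with `p¹` everywhere positive and not balanced) such
that `δ_{p⁰}·δ_{p¹} < 0` while `δ_{p⁰}·ℓ_{p¹} > 0`, where
`ℓ_{p¹} = v_{p¹}/‖v_{p¹}‖` and `v_{p¹}(j) = log(p¹(e_j)/p¹(−e_j))`. -/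
theorem exists_opposing_drifts_but_transient :
    ∃ d : ℕ, 2 ≤ d ∧
      ∃ p0 p1 : Fin d × Bool → ℝ,
        (∀ js : Fin d × Bool, 0 ≤ p0 js) ∧ (∑ js : Fin d × Bool, p0 js = 1) ∧
        (∀ js : Fin d × Bool, 0 < p1 js) ∧ (∑ js : Fin d × Bool, p1 js = 1) ∧
        (∃ j : Fin d, p1 (j, true) ≠ p1 (j, false)) ∧
        (∑ j : Fin d, (p0 (j, true) - p0 (j, false)) * (p1 (j, true) - p1 (j, false)) < 0) ∧
        (0 < ∑ j : Fin d, (p0 (j, true) - p0 (j, false)) *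
            ((Real.sqrt (∑ i : Fin d, Real.log (p1 (i, true) / p1 (i, false)) ^ 2))⁻¹ *
              Real.log (p1 (j, true) / p1 (j, false)))) := by
  refine ⟨2, le_rfl,
    fun js => if js.1 = 0 then (if js.2 then 0 else 1 / 2) else (if js.2 then 1 / 2 else 0),
    fun js => if js.1 = 0 then (if js.2 then 6 / 10 else 3 / 10)
      else (if js.2 then 9 / 100 else 1 / 100), ?_, ?_, ?_, ?_, ⟨0, ?_⟩, ?_, ?_⟩
  · intro js
    dsimp only
    split_ifs <;> norm_num
  · norm_num [Fintype.sum_prod_type]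
  · intro js
    dsimp only
    split_ifs <;> norm_num
  · norm_num [Fintype.sum_prod_type]
  · norm_num
  · norm_num [Fin.sum_univ_two]
  · have log_two_pos : 0 < Real.log 2 := Real.log_pos (by norm_num)
    have log_two_lt : Real.log 2 < Real.log 9 := Real.log_lt_log (by norm_num) (by norm_num)
    have norm_inv_pos : 0 < (Real.sqrt (Real.log 2 ^ 2 + Real.log 9 ^ 2))⁻¹ := by positivity
    norm_num [Fin.sum_univ_two]
    nlinarith [mul_pos norm_inv_pos (sub_pos.mpr log_two_lt)]
end
end

section
/- There exist a dimension d ≥ 2 and probability mass functions p⁰ and p¹ on the 2d signed standard basis vectors of ℤ^d, with p¹(e) > 0 for every such e and p¹ not balanced, such that δ_{p⁰}·δ_{p¹} > 0 while δ_{p⁰}·ℓ_{p¹} < 0. (Thus the biased random walk on the trace of a biased random walk can be recurrent even when the two drifts point in the same direction.) -/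
noncomputable section

/-- **Recurrence despite aligned drifts**: there exist `d ≥ 2` and pmfs `p⁰`, `p¹` on the
signed standard basis vectors of `ℤ^d` (with `p¹` everywhere positive and not balanced) such
that `δ_{p⁰}·δ_{p¹} > 0` while `δ_{p⁰}·ℓ_{p¹} < 0`, where
`ℓ_{p¹} = v_{p¹}/‖v_{p¹}‖` and `v_{p¹}(j) = log(p¹(e_j)/p¹(−e_j))`. -/
theorem exists_aligned_drifts_but_recurrent :
    ∃ d : ℕ, 2 ≤ d ∧
      ∃ p0 p1 : Fin d × Bool → ℝ,
        (∀ js : Fin d × Bool, 0 ≤ p0 js) ∧ (∑ js : Fin d × Bool, p0 js = 1) ∧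
        (∀ js : Fin d × Bool, 0 < p1 js) ∧ (∑ js : Fin d × Bool, p1 js = 1) ∧
        (∃ j : Fin d, p1 (j, true) ≠ p1 (j, false)) ∧
        (0 < ∑ j : Fin d, (p0 (j, true) - p0 (j, false)) * (p1 (j, true) - p1 (j, false))) ∧
        (∑ j : Fin d, (p0 (j, true) - p0 (j, false)) *
            ((Real.sqrt (∑ i : Fin d, Real.log (p1 (i, true) / p1 (i, false)) ^ 2))⁻¹ *
              Real.log (p1 (j, true) / p1 (j, false))) < 0) := by
  refine ⟨2, le_rfl,
    fun js => ![cond js.2 (1 / 2) 0, cond js.2 0 (1 / 2)] js.1,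
    fun js => ![cond js.2 (1 / 2) (1 / 4), cond js.2 (1 / 5) (1 / 20)] js.1,
    ?_, ?_, ?_, ?_, ⟨0, ?_⟩, ?_, ?_⟩
  · rintro ⟨j, b⟩
    fin_cases j <;> cases b <;> norm_num
  · norm_num [Fintype.sum_prod_type]
  · rintro ⟨j, b⟩
    fin_cases j <;> cases b <;> norm_num
  · norm_num [Fintype.sum_prod_type]
  · norm_num
  · norm_num [Fin.sum_univ_two]
  · have hlog2 : 0 < Real.log 2 := Real.log_pos one_lt_two
    have hlog4 : Real.log 4 = 2 * Real.log 2 := by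
      rw [show (4 : ℝ) = 2 ^ 2 by norm_num, Real.log_pow]
      norm_num
    norm_num [Fin.sum_univ_two, hlog4]
    set r := √(Real.log 2 ^ 2 + (2 * Real.log 2) ^ 2)
    have hr_pos : 0 < r := Real.sqrt_pos.mpr (by positivity)
    have hprod : 0 < r⁻¹ * Real.log 2 := by positivity
    linarith
end
end

section
/- For the two-parameter family p⁰, p¹, with α := exp(t₁) where t₁ is the unique strictly positive solution of φ(t₁) = 1, and β = γ₁^{√k₁}, one has (log α)/(log β) > 1 if and only if k₁(γ₁−1) < (min(k₀,k₁))(γ₀−1), and (log α)/(log β) < 1 if and only if k₁(γ₁−1) > (min(k₀,k₁))(γ₀−1). (The quantity κ := (log α)/(log β) exceeding 1 is precisely the criterion for ballisticity of the biased random walk on the trace of the biased random walk in this example.) -/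
noncomputable section

/-- Dot product of a vector of `ℤ^d` with a vector of `ℝ^d`. -/
def zdot {d : ℕ} (x : Fin d → ℤ) (ℓ : Fin d → ℝ) : ℝ := ∑ j, (x j : ℝ) * ℓ j

/-- Summing the indicator of the first `k` coordinates of `Fin d` gives `k`. -/
theorem sum_indicator_val_lt {d k : ℕ} (hk : k ≤ d) :
    ∑ j : Fin d, (if (j : ℕ) < k then (1 : ℝ) else 0) = k := by
  rw [Finset.sum_boole, Fin.card_filter_val_lt, min_eq_right hk]

/-- The scalar product of a signed basis vector with `ℓ` is the signed coordinate of `ℓ`. -/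
theorem zdot_sgnBasis {d : ℕ} (j : Fin d) (b : Bool) (ℓ : Fin d → ℝ) :
    zdot (sgnBasis (j, b)) ℓ = (if b then 1 else -1) * ℓ j := by
  unfold zdot sgnBasis
  rw [Finset.sum_eq_single j]
  · cases b <;> simp
  · intro i _ hi
    simp [Pi.single_eq_of_ne hi]
  · simp

/-- The total weight of the steps of the `k0`-biased walk, tilted by a factor `u` along the first
`k1` coordinates. -/
theorem sum_tilted_weights {d k0 k1 : ℕ} (hk0d : k0 ≤ d) (hk1d : k1 ≤ d) (g u : ℝ) :
    ∑ j : Fin d, ((1 + g * (if (j : ℕ) < k0 then 1 else 0)) *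
        (if (j : ℕ) < k1 then u⁻¹ else 1) + (if (j : ℕ) < k1 then u else 1)) =
      2 * d + k0 * g + k1 * (u + u⁻¹ - 2) + (min k0 k1 : ℕ) * (g * (u⁻¹ - 1)) := by
  have expand : ∀ j : Fin d, (1 + g * (if (j : ℕ) < k0 then 1 else 0)) *
        (if (j : ℕ) < k1 then u⁻¹ else 1) + (if (j : ℕ) < k1 then u else 1) =
      2 + (if (j : ℕ) < k0 then 1 else 0) * g
        + (if (j : ℕ) < k1 then 1 else 0) * (u + u⁻¹ - 2)
        + (if (j : ℕ) < min k0 k1 then 1 else 0) * (g * (u⁻¹ - 1)) := by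
    intro j
    simp only [lt_min_iff]
    by_cases h0 : (j : ℕ) < k0 <;> by_cases h1 : (j : ℕ) < k1 <;> simp [h0, h1] <;> ring
  simp only [expand, Finset.sum_add_distrib, ← Finset.sum_mul]
  rw [sum_indicator_val_lt hk0d, sum_indicator_val_lt hk1d,
    sum_indicator_val_lt ((min_le_left k0 k1).trans hk0d)]
  simp [mul_comm]

/-- **Ballisticity criterion for the two-parameter family**: with `α = exp t₁` (where
`t₁ > 0` is the unique root of `φ(t₁) = 1`) and `β = γ₁^{√k₁}`, one has
`log α / log β > 1 ↔ k₁(γ₁−1) < min(k₀,k₁)(γ₀−1)` and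
`log α / log β < 1 ↔ k₁(γ₁−1) > min(k₀,k₁)(γ₀−1)`. -/
theorem two_parameter_family_ballisticity_criterion
    {d : ℕ} (hd : 0 < d)
    (k0 k1 : ℕ) (hk0 : 1 ≤ k0) (hk0d : k0 ≤ d) (hk1 : 1 ≤ k1) (hk1d : k1 ≤ d)
    (γ0 γ1 : ℝ) (hγ0 : 1 < γ0) (hγ1 : 1 < γ1)
    (p0 p1 : Fin d × Bool → ℝ)
    (hp0 : ∀ js : Fin d × Bool,
      p0 js = (1 + (γ0 - 1) * (if js.2 = true ∧ (js.1 : ℕ) < k0 then 1 else 0))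
        / (2 * d + k0 * (γ0 - 1)))
    (hp1 : ∀ js : Fin d × Bool,
      p1 js = (1 + (γ1 - 1) * (if js.2 = true ∧ (js.1 : ℕ) < k1 then 1 else 0))
        / (2 * d + k1 * (γ1 - 1)))
    (v : Fin d → ℝ) (hv : ∀ j, v j = Real.log (p1 (j, true) / p1 (j, false)))
    (ℓ : Fin d → ℝ) (hℓ : ℓ = (Real.sqrt (∑ j, v j ^ 2))⁻¹ • v)
    (β : ℝ) (hβ : β = Real.exp (Real.sqrt (∑ j, v j ^ 2)))
    (φ : ℝ → ℝ)
    (hφ : ∀ t : ℝ, φ t = ∑ js : Fin d × Bool, p0 js * Real.exp (-t * zdot (sgnBasis js) ℓ))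
    (t₁ : ℝ) (ht₁pos : 0 < t₁) (ht₁ : φ t₁ = 1)
    (ht₁uniq : ∀ t : ℝ, 0 < t → φ t = 1 → t = t₁) :
    (1 < Real.log (Real.exp t₁) / Real.log β ↔
        (k1 : ℝ) * (γ1 - 1) < (min k0 k1 : ℕ) * (γ0 - 1)) ∧
      (Real.log (Real.exp t₁) / Real.log β < 1 ↔
        (min k0 k1 : ℕ) * (γ0 - 1) < (k1 : ℝ) * (γ1 - 1)) := by
  have hg0 : 0 < γ0 - 1 := sub_pos.mpr hγ0
  have hg1 : 0 < γ1 - 1 := sub_pos.mpr hγ1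
  have hdR : (0 : ℝ) < d := Nat.cast_pos.mpr hd
  have hk1R : (0 : ℝ) < k1 := Nat.cast_pos.mpr hk1
  have hZ0 : 0 < 2 * (d : ℝ) + k0 * (γ0 - 1) := by positivity
  have hZ1 : 0 < 2 * (d : ℝ) + k1 * (γ1 - 1) := by positivity
  have hL : 0 < Real.log γ1 := Real.log_pos hγ1
  have hs : 0 < √(k1 : ℝ) := Real.sqrt_pos.mpr hk1R
  have v_eq : ∀ j, v j = if (j : ℕ) < k1 then Real.log γ1 else 0 := by
    intro j
    rw [hv, hp1, hp1, div_div_div_cancel_right₀ hZ1.ne']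
    by_cases h : (j : ℕ) < k1 <;> simp [h]
  have norm_v : √(∑ j, v j ^ 2) = √(k1 : ℝ) * Real.log γ1 := by
    have : ∀ j, v j ^ 2 = (if (j : ℕ) < k1 then 1 else 0) * Real.log γ1 ^ 2 := by
      intro j
      rw [v_eq]
      split_ifs <;> simp
    simp only [this]
    rw [← Finset.sum_mul, sum_indicator_val_lt hk1d, Real.sqrt_mul hk1R.le, Real.sqrt_sq hL.le]
  have ℓ_eq : ∀ j, ℓ j = if (j : ℕ) < k1 then (√(k1 : ℝ))⁻¹ else 0 := by
    intro j
    rw [hℓ, Pi.smul_apply, norm_v, v_eq]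
    split_ifs
    · simp only [smul_eq_mul]
      field_simp
    · simp
  set u : ℝ := Real.exp (t₁ / √(k1 : ℝ)) with hu
  have hu1 : 1 < u := Real.one_lt_exp_iff.mpr (div_pos ht₁pos hs)
  have root : (k1 : ℝ) * (u - 1) = (min k0 k1 : ℕ) * (γ0 - 1) := by
    have tilt : ∀ j : Fin d, ∑ b : Bool,
        p0 (j, b) * Real.exp (-t₁ * zdot (sgnBasis (j, b)) ℓ) =
        ((1 + (γ0 - 1) * (if (j : ℕ) < k0 then 1 else 0)) *
          (if (j : ℕ) < k1 then u⁻¹ else 1) + (if (j : ℕ) < k1 then u else 1)) /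
          (2 * d + k0 * (γ0 - 1)) := by
      intro j
      simp only [Fintype.sum_bool, hp0, zdot_sgnBasis, ℓ_eq]
      by_cases h1 : (j : ℕ) < k1 <;> simp [h1, hu, ← Real.exp_neg, div_eq_mul_inv] <;> ring
    rw [hφ, Fintype.sum_prod_type] at ht₁
    simp only [tilt] at ht₁
    rw [← Finset.sum_div, sum_tilted_weights hk0d hk1d, div_eq_one_iff_eq hZ0.ne'] at ht₁
    have hu0 : u ≠ 0 := by positivity
    have key : (u - 1) * (k1 * (u - 1) - (min k0 k1 : ℕ) * (γ0 - 1)) = 0 := by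
      have hinv : u * u⁻¹ = 1 := mul_inv_cancel₀ hu0
      linear_combination u * ht₁ - ((k1 : ℝ) + (min k0 k1 : ℕ) * (γ0 - 1)) * hinv
    have := (mul_eq_zero.mp key).resolve_left (sub_pos.mpr hu1).ne'
    linarith
  have ratio : Real.log (Real.exp t₁) / Real.log β = Real.log u / Real.log γ1 := by
    rw [hβ, norm_v, Real.log_exp, Real.log_exp, hu, Real.log_exp, div_div]
  have hu0 : 0 < u := by positivity
  have hγ1pos : 0 < γ1 := by positivity
  rw [ratio, ← root, one_lt_div hL, div_lt_one hL, Real.log_lt_log_iff hγ1pos hu0,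
    Real.log_lt_log_iff hu0 hγ1pos, mul_lt_mul_iff_right₀ hk1R, mul_lt_mul_iff_right₀ hk1R,
    sub_lt_sub_iff_right, sub_lt_sub_iff_right]
  exact ⟨Iff.rfl, Iff.rfl⟩
end
end
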